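/- Let Z and Y be complex Banach spaces, let m ≥ 2 and 1 ≤ λ ≤ 2. For each k ∈ {1,…,m}, let q(k) = (2,…,2,λ,2,…,2) ∈ [1,2]^m with λ in the k-th position. Suppose T is a linear map from Z into the space of Y-valued families indexed by ℕ^m such that, for every k ∈ {1,…,m}, ‖Tz‖_{ℓ_{q(k)}(Y)} ≤ C‖z‖_Z for all z ∈ Z. Then for every q = (q_1,…,q_m) ∈ [λ,2]^m with 1/q_1 + ⋯ + 1/q_m = (m−1)/2 + 1/λ, one has ‖Tz‖_{ℓ_q(Y)} ≤ C‖z‖_Z for all z ∈ Z. -/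

import Mathlib

open scoped ENNReal NNReal

/-- Iterated mixed `ℓ_q(Y)`-norm of a family `a : ℕ^m → ℝ≥0∞` (typically `a i = ‖x i‖₊` for a
`Y`-valued family `x`) with exponents `q = (q 0, …, q (m-1))`:
`(Σ_{i₁} ( … ( Σ_{i_m} a_i ^ q_m )^{q_{m-1}/q_m} … )^{q_1/q_2})^{1/q_1}`. -/
noncomputable def mixedNorm : (m : ℕ) → (Fin m → ℝ) → ((Fin m → ℕ) → ℝ≥0∞) → ℝ≥0∞
  | 0, _, a => a finZeroElim
  | (m + 1), q, a =>
      (∑' i : ℕ, (mixedNorm m (fun j => q j.succ) (fun is => a (Fin.cons i is))) ^ q 0) ^ (1 / q 0)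

open MeasureTheory in
/-- **Hölder's inequality** for series of products of several nonnegative extended reals, with
weights summing to one. -/
theorem ENNReal.tsum_prod_rpow_le {ι α : Type*} (s : Finset ι) (f : ι → α → ℝ≥0∞) {p : ι → ℝ}
    (hp : ∑ k ∈ s, p k = 1) (hp0 : ∀ k ∈ s, 0 ≤ p k) :
    ∑' i, ∏ k ∈ s, f k i ^ p k ≤ ∏ k ∈ s, (∑' i, f k i) ^ p k := by
  let _ : MeasurableSpace α := ⊤
  simpa only [lintegral_count] using
    ENNReal.lintegral_prod_norm_pow_le (μ := Measure.count) s
      (fun k _ => (measurable_from_top (f := f k)).aemeasurable) hp hp0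

theorem ENNReal.prod_rpow_eq_self {ι : Type*} (s : Finset ι) (x : ℝ≥0∞) {θ : ι → ℝ}
    (hθ : ∑ k ∈ s, θ k = 1) (hθ0 : ∀ k ∈ s, 0 ≤ θ k) : ∏ k ∈ s, x ^ θ k = x := by
  have h : ∀ t ⊆ s, ∏ k ∈ t, x ^ θ k = x ^ ∑ k ∈ t, θ k := by
    classical
    intro t
    induction t using Finset.induction_on with
    | empty => simp
    | insert k t hk ih =>
      intro hts
      rw [Finset.insert_subset_iff] at hts
      rw [Finset.prod_insert hk, Finset.sum_insert hk, ih hts.2,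
        ENNReal.rpow_add_of_nonneg _ _ (hθ0 k hts.1)
          (Finset.sum_nonneg fun j hj => hθ0 j (hts.2 hj))]
  rw [h s subset_rfl, hθ, ENNReal.rpow_one]

/-- **Hölder's inequality** for mixed norms: if `1 / q = ∑ k, θ k / p k` coordinatewise, the mixed
norm is log-convex in the reciprocals of the exponents. -/
theorem mixedNorm_prod_rpow_le {ι : Type*} (s : Finset ι) {θ : ι → ℝ} (hθ0 : ∀ k ∈ s, 0 ≤ θ k)
    (m : ℕ) (q : Fin m → ℝ) (p : ι → Fin m → ℝ) (a : (Fin m → ℕ) → ℝ≥0∞)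
    (hθ : ∑ k ∈ s, θ k = 1) (hq : ∀ j, 0 < q j) (hp : ∀ k ∈ s, ∀ j, 0 < p k j)
    (hqp : ∀ j, 1 / q j = ∑ k ∈ s, θ k / p k j) :
    mixedNorm m q a ≤ ∏ k ∈ s, mixedNorm m (p k) a ^ θ k := by
  induction m with
  | zero => simp only [mixedNorm]; exact (ENNReal.prod_rpow_eq_self s _ hθ hθ0).ge
  | succ m ih =>
    simp only [mixedNorm]
    set N : ι → ℕ → ℝ≥0∞ := fun k i =>
      mixedNorm m (fun j => p k j.succ) (fun is => a (Fin.cons i is)) with hN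
    have hq0 : 0 < q 0 := hq 0
    calc _ ≤ (∑' i, ∏ k ∈ s, (N k i ^ p k 0) ^ (θ k * q 0 / p k 0)) ^ (1 / q 0) := by
          gcongr with i
          calc _ ≤ (∏ k ∈ s, N k i ^ θ k) ^ q 0 := by
                gcongr
                exact ih _ _ _ (fun j => hq _) (fun k hk j => hp k hk _) (fun j => hqp _)
            _ = _ := by
                rw [← ENNReal.prod_rpow_of_nonneg hq0.le]
                refine Finset.prod_congr rfl fun k hk => ?_
                have := (hp k hk 0).ne'
                rw [← ENNReal.rpow_mul, ← ENNReal.rpow_mul]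
                congr 1
                field_simp
      _ ≤ (∏ k ∈ s, (∑' i, N k i ^ p k 0) ^ (θ k * q 0 / p k 0)) ^ (1 / q 0) := by
          gcongr
          refine ENNReal.tsum_prod_rpow_le s (fun k i => N k i ^ p k 0) ?_ fun k hk =>
            div_nonneg (mul_nonneg (hθ0 k hk) hq0.le) (hp k hk 0).le
          calc _ = (∑ k ∈ s, θ k / p k 0) * q 0 := by
                rw [Finset.sum_mul]
                exact Finset.sum_congr rfl fun k _ => by ring
            _ = 1 := by rw [← hqp 0]; field_simp
      _ = _ := by
          rw [← ENNReal.prod_rpow_of_nonneg (by positivity)]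
          refine Finset.prod_congr rfl fun k hk => ?_
          have := (hp k hk 0).ne'
          rw [← ENNReal.rpow_mul, ← ENNReal.rpow_mul]
          congr 1
          field_simp

/-- **Corollary 2.3.** Let `m ≥ 2`, `1 ≤ λ ≤ 2` and, for `k ∈ {1, …, m}`, let
`q(k) = (2, …, 2, λ, 2, …, 2)` with `λ` in the `k`-th position. If a linear map `T` from a
Banach space `Z` into `Y`-valued families indexed by `ℕ^m` is bounded by `C` from `Z` into
`ℓ_{q(k)}(Y)` for every `k`, then it is bounded by `C` from `Z` into `ℓ_q(Y)` for every
`q ∈ [λ,2]^m` with `1/q₁ + ⋯ + 1/q_m = (m-1)/2 + 1/λ`. -/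
theorem interpolation_corollary (Z Y : Type*)
    [NormedAddCommGroup Z] [NormedSpace ℂ Z] [CompleteSpace Z]
    [NormedAddCommGroup Y] [NormedSpace ℂ Y] [CompleteSpace Y]
    (m : ℕ) (hm : 2 ≤ m) (lam : ℝ) (hlam1 : 1 ≤ lam) (hlam2 : lam ≤ 2)
    (T : Z →ₗ[ℂ] ((Fin m → ℕ) → Y)) (C : ℝ)
    (hT : ∀ k : Fin m, ∀ z : Z,
      mixedNorm m (fun j => if j = k then lam else 2) (fun is => (‖T z is‖₊ : ℝ≥0∞)) ≤
        ENNReal.ofReal (C * ‖z‖))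
    (q : Fin m → ℝ) (hq : ∀ j, lam ≤ q j ∧ q j ≤ 2)
    (hsum : ∑ j, 1 / q j = (m - 1) / 2 + 1 / lam) :
    ∀ z : Z, mixedNorm m q (fun is => (‖T z is‖₊ : ℝ≥0∞)) ≤ ENNReal.ofReal (C * ‖z‖) := by
  intro z
  have hl : 0 < lam := by linarith
  have hqpos : ∀ j, 0 < q j := fun j => hl.trans_le (hq j).1
  rcases hlam2.eq_or_lt with rfl | hlt
  · have hq2 : q = fun j => if j = (⟨0, by omega⟩ : Fin m) then 2 else 2 := by
      funext j
      simpa using le_antisymm (hq j).2 (hq j).1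
    rw [hq2]
    exact hT _ z
  have hd : 0 < 1 / lam - 1 / 2 := sub_pos.2 (one_div_lt_one_div_of_lt hl hlt)
  set θ : Fin m → ℝ := fun j => (1 / q j - 1 / 2) / (1 / lam - 1 / 2) with hθdef
  have hθ0 : ∀ k, 0 ≤ θ k := fun k =>
    div_nonneg (sub_nonneg.2 (one_div_le_one_div_of_le (hqpos k) (hq k).2)) hd.le
  have hθ : ∑ k, θ k = 1 := by
    rw [← Finset.sum_div, Finset.sum_sub_distrib, hsum, div_eq_one_iff_eq hd.ne']
    simp
    ring
  have hqp : ∀ j, 1 / q j = ∑ k, θ k / (if j = k then lam else 2) := by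
    intro j
    have h : ∀ k, θ k / (if j = k then lam else 2) =
        θ k * (1 / 2) + if j = k then θ k * (1 / lam - 1 / 2) else 0 := by
      intro k
      split_ifs <;> ring
    simp only [h]
    rw [Finset.sum_add_distrib, ← Finset.sum_mul, hθ, Finset.sum_ite_eq,
      if_pos (Finset.mem_univ j), hθdef, div_mul_cancel₀ _ hd.ne']
    ring
  calc _ ≤ ∏ k, mixedNorm m (fun j => if j = k then lam else 2)
          (fun is => (‖T z is‖₊ : ℝ≥0∞)) ^ θ k := by
        refine mixedNorm_prod_rpow_le Finset.univ (fun k _ => hθ0 k) m q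
          (fun k j => if j = k then lam else 2) _ hθ hqpos (fun k _ j => ?_) hqp
        split_ifs <;> linarith
    _ ≤ ∏ k, ENNReal.ofReal (C * ‖z‖) ^ θ k :=
        Finset.prod_le_prod' fun k _ => ENNReal.rpow_le_rpow (hT k z) (hθ0 k)
    _ = _ := ENNReal.prod_rpow_eq_self _ _ hθ fun k _ => hθ0 k
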